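/- arXiv:1811.02450 — 3 statements merged into one kernel-verified Lean document; each statement's English description precedes it below -/
import Mathlib

section
/- For every n ≥ 1 and every m with n ≤ m (including m = ∞), c_{s+}(n, ℓ₁^m) = κ(n), where κ(n) := ‖e₁∨⋯∨eₙ‖_{πs+} computed in ℓ₁ⁿ. Moreover, for every ordered normed space E and every symmetric tensor 𝐱 ∈ E^∨n one has ‖𝐱‖_{πs+} ≤ κ(n)·c₊(E)ⁿ·‖𝐱‖_π, and κ(n) is the smallest constant with this property, i.e., sup_E c_{s+}(n,E)/c₊(E)ⁿ = κ(n). -/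
open scoped BigOperators TensorProduct
open PiTensorProduct

noncomputable section

/-- The projective tensor norm `‖·‖_π` on the `n`-th algebraic tensor power `E^⊗n`. -/
def projNorm {E : Type*} [NormedAddCommGroup E] [NormedSpace ℝ E] (n : ℕ)
    (t : ⨂[ℝ] (_ : Fin n), E) : ℝ :=
  sInf {s : ℝ | ∃ (N : ℕ) (a : Fin N → ℝ) (x : Fin N → Fin n → E),
    t = ∑ k, a k • (⨂ₜ[ℝ] i, x k i) ∧ s = ∑ k, |a k| * ∏ i, ‖x k i‖}

/-- The positive projective tensor norm `‖·‖_{π+}` on `E^⊗n`: only decompositions into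
elementary tensors of elements of the positive cone `P` are allowed. -/
def projNormPos {E : Type*} [NormedAddCommGroup E] [NormedSpace ℝ E] (P : Set E) (n : ℕ)
    (t : ⨂[ℝ] (_ : Fin n), E) : ℝ :=
  sInf {s : ℝ | ∃ (N : ℕ) (a : Fin N → ℝ) (x : Fin N → Fin n → E),
    (∀ k i, x k i ∈ P) ∧ t = ∑ k, a k • (⨂ₜ[ℝ] i, x k i) ∧
    s = ∑ k, |a k| * ∏ i, ‖x k i‖}

/-- The symmetric projective tensor norm `‖·‖_{πs}` (decompositions into tensor powers). -/
def symProjNorm {E : Type*} [NormedAddCommGroup E] [NormedSpace ℝ E] (n : ℕ)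
    (t : ⨂[ℝ] (_ : Fin n), E) : ℝ :=
  sInf {s : ℝ | ∃ (N : ℕ) (a : Fin N → ℝ) (x : Fin N → E),
    t = ∑ k, a k • (⨂ₜ[ℝ] (_ : Fin n), x k) ∧ s = ∑ k, |a k| * ‖x k‖ ^ n}

/-- The positive symmetric projective tensor norm `‖·‖_{πs+}` (decompositions into tensor
powers of elements of the positive cone `P`). -/
def symProjNormPos {E : Type*} [NormedAddCommGroup E] [NormedSpace ℝ E] (P : Set E) (n : ℕ)
    (t : ⨂[ℝ] (_ : Fin n), E) : ℝ :=
  sInf {s : ℝ | ∃ (N : ℕ) (a : Fin N → ℝ) (x : Fin N → E),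
    (∀ k, x k ∈ P) ∧ t = ∑ k, a k • (⨂ₜ[ℝ] (_ : Fin n), x k) ∧
    s = ∑ k, |a k| * ‖x k‖ ^ n}

/-- `‖x‖₊ = inf{‖y‖+‖z‖ : x = y − z, y,z ∈ P}`. -/
def normPlus {E : Type*} [NormedAddCommGroup E] (P : Set E) (x : E) : ℝ :=
  sInf {r : ℝ | ∃ y ∈ P, ∃ z ∈ P, x = y - z ∧ r = ‖y‖ + ‖z‖}

/-- `c₊(E) = sup{‖x‖₊ : ‖x‖ ≤ 1}`. -/
def cPlus {E : Type*} [NormedAddCommGroup E] (P : Set E) : ℝ :=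
  sSup {r : ℝ | ∃ x : E, ‖x‖ ≤ 1 ∧ r = normPlus P x}

/-- `P` is a closed generating cone in `E`, i.e. `E` with `P` is an ordered normed space
with `E = P − P`. -/
def IsGenCone {E : Type*} [NormedAddCommGroup E] [NormedSpace ℝ E] (P : Set E) : Prop :=
  IsClosed P ∧ (∀ x ∈ P, ∀ y ∈ P, x + y ∈ P) ∧
    (∀ (c : ℝ), 0 ≤ c → ∀ x ∈ P, c • x ∈ P) ∧
    ∀ x : E, ∃ y ∈ P, ∃ z ∈ P, x = y - z

/-- `c₊(E)` is finite. -/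
def CPlusFinite {E : Type*} [NormedAddCommGroup E] (P : Set E) : Prop :=
  BddAbove {r : ℝ | ∃ x : E, ‖x‖ ≤ 1 ∧ r = normPlus P x}

/-- The `j`-th standard basis vector of `ℓ₁^m`. -/
def l1e (m : ℕ) (j : Fin m) : PiLp 1 fun _ : Fin m => ℝ :=
  (WithLp.equiv 1 (Fin m → ℝ)).symm (Pi.single j 1)

/-- The positive cone of coordinatewise nonnegative vectors in `ℓ₁^m`. -/
def l1cone (m : ℕ) : Set (PiLp 1 fun _ : Fin m => ℝ) := {x | ∀ i, 0 ≤ x i}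

/-- `κ(n) := ‖e₁ ∨ ⋯ ∨ eₙ‖_{πs+}` computed in `ℓ₁ⁿ`, where
`x₁ ∨ ⋯ ∨ xₙ = (1/n!)·Σ_{σ ∈ Sₙ} x_{σ(1)} ⊗ ⋯ ⊗ x_{σ(n)}`. -/
def kappa (n : ℕ) : ℝ :=
  symProjNormPos (l1cone n) n
    ((n.factorial : ℝ)⁻¹ • ∑ σ : Equiv.Perm (Fin n), ⨂ₜ[ℝ] i, l1e n (σ i))

/-- `c_{s+}(n,E) = sup{‖𝐱‖_{πs+}/‖𝐱‖_π : 0 ≠ 𝐱 ∈ E^∨n}`, where `E^∨n` is the space of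
symmetric tensors (the span of the tensor powers). -/
def csPlus (E : Type*) [NormedAddCommGroup E] [NormedSpace ℝ E] (P : Set E) (n : ℕ) : ℝ :=
  sSup {r : ℝ | ∃ t : ⨂[ℝ] (_ : Fin n), E,
    t ∈ Submodule.span ℝ {u : ⨂[ℝ] (_ : Fin n), E | ∃ x : E, u = ⨂ₜ[ℝ] (_ : Fin n), x} ∧
    t ≠ 0 ∧ r = symProjNormPos P n t / projNorm n t}

section aux

variable {E : Type*} [NormedAddCommGroup E] [NormedSpace ℝ E]

/-- A decomposition into positive powers with cost at most `s`. -/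
def DecP (P : Set E) (n : ℕ) (t : ⨂[ℝ] (_ : Fin n), E) (s : ℝ) : Prop :=
  ∃ (N : ℕ) (a : Fin N → ℝ) (x : Fin N → E),
    (∀ k, x k ∈ P) ∧ t = ∑ k, a k • (⨂ₜ[ℝ] (_ : Fin n), x k) ∧
    ∑ k, |a k| * ‖x k‖ ^ n ≤ s

theorem DecP.zero (P : Set E) (n : ℕ) : DecP P n 0 0 :=
  ⟨0, Fin.elim0, Fin.elim0, fun k => k.elim0, by simp, by simp⟩

theorem DecP.mono {P : Set E} {n : ℕ} {t : ⨂[ℝ] (_ : Fin n), E} {s s' : ℝ}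
    (h : DecP P n t s) (hs : s ≤ s') : DecP P n t s' := by
  obtain ⟨N, a, x, h1, h2, h3⟩ := h
  exact ⟨N, a, x, h1, h2, h3.trans hs⟩

theorem DecP.add {P : Set E} {n : ℕ} {t t' : ⨂[ℝ] (_ : Fin n), E} {s s' : ℝ}
    (h : DecP P n t s) (h' : DecP P n t' s') : DecP P n (t + t') (s + s') := by
  obtain ⟨N, a, x, h1, h2, h3⟩ := h
  obtain ⟨N', a', x', h1', h2', h3'⟩ := h'
  refine ⟨N + N', Fin.append a a', Fin.append x x', ?_, ?_, ?_⟩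
  · intro k
    refine Fin.addCases (fun i => ?_) (fun i => ?_) k
    · simpa using h1 i
    · simpa using h1' i
  · simp [Fin.sum_univ_add, h2, h2']
  · simp only [Fin.sum_univ_add, Fin.append_left, Fin.append_right]
    exact add_le_add h3 h3'

theorem DecP.smul {P : Set E} {n : ℕ} {t : ⨂[ℝ] (_ : Fin n), E} {s : ℝ} (c : ℝ)
    (h : DecP P n t s) : DecP P n (c • t) (|c| * s) := by
  obtain ⟨N, a, x, h1, h2, h3⟩ := h
  refine ⟨N, fun k => c * a k, x, h1, ?_, ?_⟩
  · simp [h2, Finset.smul_sum, mul_smul]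
  · simp only [abs_mul, mul_assoc, ← Finset.mul_sum]
    exact mul_le_mul_of_nonneg_left h3 (abs_nonneg _)

theorem DecP.sum {P : Set E} {n : ℕ} {ι : Type*} (S : Finset ι)
    (t : ι → ⨂[ℝ] (_ : Fin n), E) (s : ι → ℝ)
    (h : ∀ i ∈ S, DecP P n (t i) (s i)) : DecP P n (∑ i ∈ S, t i) (∑ i ∈ S, s i) := by
  classical
  induction S using Finset.induction_on with
  | empty => simpa using DecP.zero P n
  | insert a S ha ih =>
    rw [Finset.sum_insert ha, Finset.sum_insert ha]
    exact (h a (Finset.mem_insert_self _ _)).add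
      (ih fun i hi => h i (Finset.mem_insert_of_mem hi))

theorem DecP.pow {P : Set E} {n : ℕ} {x : E} (hx : x ∈ P) :
    DecP P n (⨂ₜ[ℝ] (_ : Fin n), x) (‖x‖ ^ n) :=
  ⟨1, fun _ => 1, fun _ => x, fun _ => hx, by simp, by simp⟩

theorem DecP.map {F : Type*} [NormedAddCommGroup F] [NormedSpace ℝ F] {P : Set E} {R : Set F}
    {n : ℕ} {t : ⨂[ℝ] (_ : Fin n), E} {s : ℝ} (T : E →ₗ[ℝ] F)
    (hT : ∀ x ∈ P, T x ∈ R) (hTn : ∀ x ∈ P, ‖T x‖ ≤ ‖x‖) (h : DecP P n t s) :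
    DecP R n (PiTensorProduct.map (fun _ => T) t) s := by
  obtain ⟨N, a, x, h1, h2, h3⟩ := h
  refine ⟨N, a, fun k => T (x k), fun k => hT _ (h1 k), ?_, le_trans ?_ h3⟩
  · simp [h2, map_sum, PiTensorProduct.map_tprod]
  · refine Finset.sum_le_sum fun k _ => ?_
    have := hTn _ (h1 k)
    gcongr

theorem DecP.mem_span {P : Set E} {n : ℕ} {t : ⨂[ℝ] (_ : Fin n), E} {s : ℝ}
    (h : DecP P n t s) : t ∈ Submodule.span ℝ
      {u : ⨂[ℝ] (_ : Fin n), E | ∃ x : E, u = ⨂ₜ[ℝ] (_ : Fin n), x} := by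
  obtain ⟨N, a, x, h1, h2, h3⟩ := h
  rw [h2]
  exact Submodule.sum_mem _ fun k _ => Submodule.smul_mem _ _ (Submodule.subset_span ⟨x k, rfl⟩)

theorem DecP.norm_le {P : Set E} {n : ℕ} {t : ⨂[ℝ] (_ : Fin n), E} {s : ℝ}
    (h : DecP P n t s) : symProjNormPos P n t ≤ s := by
  obtain ⟨N, a, x, h1, h2, h3⟩ := h
  refine le_trans (csInf_le ⟨0, ?_⟩ ⟨N, a, x, h1, h2, rfl⟩) h3
  rintro _ ⟨N, a, x, -, -, rfl⟩
  positivity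

theorem le_symPos {P : Set E} {n : ℕ} {t : ⨂[ℝ] (_ : Fin n), E} {s b : ℝ}
    (h : DecP P n t s) (hb : ∀ r, DecP P n t r → b ≤ r) : b ≤ symProjNormPos P n t := by
  obtain ⟨N, a, x, h1, h2, h3⟩ := h
  refine le_csInf ⟨_, N, a, x, h1, h2, rfl⟩ ?_
  rintro _ ⟨N, a, x, h1, h2, rfl⟩
  exact hb _ ⟨N, a, x, h1, h2, le_rfl⟩

theorem symPos_nonneg (P : Set E) (n : ℕ) (t : ⨂[ℝ] (_ : Fin n), E) :
    0 ≤ symProjNormPos P n t := by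
  apply Real.sInf_nonneg
  rintro _ ⟨N, a, x, -, -, rfl⟩
  positivity

theorem projNorm_nonneg' (n : ℕ) (t : ⨂[ℝ] (_ : Fin n), E) : 0 ≤ projNorm n t := by
  apply Real.sInf_nonneg
  rintro _ ⟨N, a, x, -, rfl⟩
  exact Finset.sum_nonneg fun k _ => mul_nonneg (abs_nonneg _)
    (Finset.prod_nonneg fun _ _ => norm_nonneg _)

/-- Symmetric product as a multilinear map. -/
def symM (E : Type*) [NormedAddCommGroup E] [NormedSpace ℝ E] (n : ℕ) :
    MultilinearMap ℝ (fun _ : Fin n => E) (⨂[ℝ] (_ : Fin n), E) :=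
  (n.factorial : ℝ)⁻¹ • ∑ σ : Equiv.Perm (Fin n),
    (PiTensorProduct.tprod ℝ).domDomCongr σ

theorem symM_apply (n : ℕ) (w : Fin n → E) :
    symM E n w = (n.factorial : ℝ)⁻¹ • ∑ σ : Equiv.Perm (Fin n), ⨂ₜ[ℝ] i, w (σ i) := by
  simp [symM]

theorem symM_const (n : ℕ) (x : E) :
    symM E n (fun _ => x) = ⨂ₜ[ℝ] (_ : Fin n), x := by
  rw [symM_apply, Finset.sum_const, Finset.card_univ, Fintype.card_perm, Fintype.card_fin,
    ← Nat.cast_smul_eq_nsmul ℝ, smul_smul, inv_mul_cancel₀, one_smul]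
  exact_mod_cast n.factorial_ne_zero

theorem map_symM {F : Type*} [NormedAddCommGroup F] [NormedSpace ℝ F] (n : ℕ) (T : E →ₗ[ℝ] F)
    (w : Fin n → E) :
    PiTensorProduct.map (fun _ => T) (symM E n w) = symM F n (fun i => T (w i)) := by
  simp [symM_apply, PiTensorProduct.map_tprod]

/-- polarization -/
theorem polar (n : ℕ) (w : Fin n → E) :
    symM E n w = (n.factorial : ℝ)⁻¹ • ∑ S : Finset (Fin n),
      (-1 : ℝ) ^ (Sᶜ.card) • ⨂ₜ[ℝ] (_ : Fin n), ∑ j ∈ S, w j := by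
  classical
  rw [symM_apply]
  congr 1
  have h1 : ∀ S : Finset (Fin n), (⨂ₜ[ℝ] (_ : Fin n), ∑ j ∈ S, w j)
      = ∑ r : Fin n → Fin n, (if ∀ i, r i ∈ S then (1 : ℝ) else 0) • ⨂ₜ[ℝ] i, w (r i) := by
    intro S
    rw [MultilinearMap.map_sum_finset]
    simp only [ite_smul, one_smul, zero_smul]
    rw [← Finset.sum_filter]
    refine Finset.sum_congr ?_ fun _ _ => rfl
    ext r
    simp [Fintype.mem_piFinset]
  simp only [h1, Finset.smul_sum, smul_smul]
  rw [Finset.sum_comm]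
  simp only [← Finset.sum_smul]
  have h2 : ∀ r : Fin n → Fin n, (∑ S : Finset (Fin n), (-1 : ℝ) ^ (Sᶜ.card) *
      (if ∀ i, r i ∈ S then (1 : ℝ) else 0)) = if Function.Surjective r then 1 else 0 := by
    intro r
    let g : Fin n → ℝ := fun a => if ∃ i, r i = a then 0 else -1
    have hp := Fintype.prod_add (fun _ : Fin n => (1 : ℝ)) g
    have e1 : ∀ S : Finset (Fin n), (-1 : ℝ) ^ (Sᶜ.card) *
      (if ∀ i, r i ∈ S then (1 : ℝ) else 0) = (∏ a ∈ S, (1 : ℝ)) * ∏ a ∈ Sᶜ, g a := by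
      intro S
      rw [Finset.prod_const_one, one_mul]
      split_ifs with h
      · rw [mul_one, ← Finset.prod_const]
        refine Finset.prod_congr rfl fun a ha => ?_
        rw [Finset.mem_compl] at ha
        simp only [g]
        rw [if_neg]
        rintro ⟨i, rfl⟩
        exact ha (h i)
      · push Not at h
        obtain ⟨i, hi⟩ := h
        rw [mul_zero]
        symm
        refine Finset.prod_eq_zero (Finset.mem_compl.2 hi) ?_
        simp [g]
    rw [Finset.sum_congr rfl fun S _ => e1 S, ← hp]
    split_ifs with h
    · refine Finset.prod_eq_one fun a _ => ?_
      simp [g, h a]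
    · simp only [Function.Surjective] at h
      push Not at h
      obtain ⟨a, ha⟩ := h
      refine Finset.prod_eq_zero (Finset.mem_univ a) ?_
      simp [g, ha]
  simp only [h2, ite_smul, one_smul, zero_smul]
  rw [← Finset.sum_filter]
  refine Finset.sum_bij (fun σ _ => ⇑σ) ?_ ?_ ?_ ?_
  · intro σ _
    simpa using σ.surjective
  · intro σ _ τ _ h
    exact DFunLike.coe_injective h
  · intro r hr
    have hs : Function.Surjective r := by simpa using hr
    exact ⟨Equiv.ofBijective r ⟨Finite.injective_iff_surjective.2 hs, hs⟩, Finset.mem_univ _, rfl⟩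
  · intro σ _
    rfl

theorem norm_l1e (m : ℕ) (j : Fin m) : ‖l1e m j‖ = 1 := by
  rw [PiLp.norm_eq_of_L1, Finset.sum_eq_single j]
  · simp [l1e]
  · intro b _ hb
    simp [l1e, hb]
  · simp

theorem l1e_apply (m : ℕ) (i j : Fin m) : l1e m j i = if i = j then 1 else 0 := by
  simp [l1e, Pi.single_apply]

theorem l1e_mem (m : ℕ) (j : Fin m) : l1e m j ∈ l1cone m := by
  intro i
  rw [l1e_apply]
  split_ifs <;> simp

theorem kappa_eq (n : ℕ) : kappa n = symProjNormPos (l1cone n) n (symM _ n (l1e n)) := by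
  rw [symM_apply]; rfl

theorem kappa_dec (n : ℕ) : ∃ s, DecP (l1cone n) n (symM _ n (l1e n)) s := by
  rw [polar]
  refine ⟨_, DecP.smul _ (DecP.sum _ _ _ fun S _ => DecP.smul _ (DecP.pow ?_))⟩
  intro i
  have : (∑ j ∈ S, l1e n j) i = ∑ j ∈ S, l1e n j i := by
    simp
  rw [this]
  exact Finset.sum_nonneg fun j _ => l1e_mem n j i

theorem kappa_pos (n : ℕ) : 0 < kappa n := by
  have hf : (0 : ℝ) < (n.factorial : ℝ)⁻¹ := by
    have := n.factorial_pos
    positivity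
  refine hf.trans_le ?_
  rw [kappa_eq]
  obtain ⟨s, hs⟩ := kappa_dec n
  refine le_symPos hs ?_
  rintro r ⟨N, a, x, -, h2, h3⟩
  let φ : MultilinearMap ℝ (fun _ : Fin n => PiLp 1 fun _ : Fin n => ℝ) ℝ :=
    (MultilinearMap.mkPiAlgebra ℝ (Fin n) ℝ).compLinearMap
      (fun i => (PiLp.projₗ 1 (fun _ : Fin n => ℝ) i : (PiLp 1 fun _ : Fin n => ℝ) →ₗ[ℝ] ℝ))
  have hφ : ∀ w, φ w = ∏ i, w i i := fun w => by simp [φ]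
  have h4 := congrArg (PiTensorProduct.lift φ) h2
  rw [symM_apply] at h4
  simp only [map_smul, map_sum, PiTensorProduct.lift.tprod, hφ, smul_eq_mul, l1e_apply] at h4
  rw [Finset.sum_eq_single (1 : Equiv.Perm (Fin n))] at h4
  · simp only [Equiv.Perm.coe_one, id, if_true, Finset.prod_const_one, mul_one] at h4
    rw [h4]
    refine le_trans (Finset.sum_le_sum fun k _ => ?_) h3
    refine (le_abs_self _).trans ?_
    rw [abs_mul, Finset.abs_prod]
    refine mul_le_mul_of_nonneg_left ?_ (abs_nonneg _)
    refine (Finset.prod_le_prod (fun _ _ => abs_nonneg _) (fun i _ => ?_)).trans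
      (b := ∏ _i : Fin n, ‖x k‖) (by simp)
    exact PiLp.norm_apply_le (x k) i
  · intro σ _ hσ
    obtain ⟨i, hi⟩ : ∃ i, σ i ≠ i := by
      by_contra! h
      exact hσ (Equiv.ext h)
    exact Finset.prod_eq_zero (Finset.mem_univ i) (by simp [hi.symm])
  · simp

theorem cone_sum {P : Set E} (hP : IsGenCone P) {ι : Type*} (S : Finset ι) (f : ι → E)
    (hf : ∀ i ∈ S, f i ∈ P) : ∑ i ∈ S, f i ∈ P := by
  classical
  obtain ⟨-, hadd, hsm, hgen⟩ := hP
  have h0 : (0 : E) ∈ P := by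
    obtain ⟨y, hy, -⟩ := hgen 0
    simpa using hsm 0 le_rfl y hy
  induction S using Finset.induction_on with
  | empty => simpa
  | insert a S ha ih =>
    rw [Finset.sum_insert ha]
    exact hadd _ (hf a (Finset.mem_insert_self _ _)) _
      (ih fun i hi => hf i (Finset.mem_insert_of_mem hi))

theorem dec_pos {P : Set E} (hP : IsGenCone P) {n : ℕ} {κ : ℝ}
    (hκ : DecP (l1cone n) n (symM _ n (l1e n)) κ) (w : Fin n → E) (hw : ∀ i, w i ∈ P) :
    DecP P n (symM E n w) ((∏ i, ‖w i‖) * κ) := by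
  let v : Fin n → E := fun i => ‖w i‖⁻¹ • w i
  have hv : ∀ i, v i ∈ P := fun i => hP.2.2.1 _ (by positivity) _ (hw i)
  have hvn : ∀ i, ‖v i‖ ≤ 1 := by
    intro i
    simp only [v, norm_smul, norm_inv, norm_norm]
    exact inv_mul_le_one
  have hwv : w = fun i => ‖w i‖ • v i := by
    funext i
    by_cases h : w i = 0
    · simp [v, h]
    · simp [v, smul_smul, mul_inv_cancel₀ (norm_ne_zero_iff.2 h)]
  let T : (PiLp 1 fun _ : Fin n => ℝ) →ₗ[ℝ] E :=
    { toFun := fun x => ∑ j, x j • v j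
      map_add' := by intro x y; simp [add_smul, Finset.sum_add_distrib]
      map_smul' := by intro c x; simp [mul_smul, Finset.smul_sum] }
  have hTa : ∀ x, T x = ∑ j, x j • v j := fun x => rfl
  have hTe : ∀ j, T (l1e n j) = v j := by
    intro j
    simp [T, l1e_apply]
  have h1 : DecP P n (symM E n v) κ := by
    have := DecP.map (R := P) T ?_ ?_ hκ
    · rw [map_symM] at this
      simpa only [hTe] using this
    · intro x hx
      rw [hTa]
      exact cone_sum hP _ _ fun j _ => hP.2.2.1 _ (hx j) _ (hv j)
    · intro x _
      rw [PiLp.norm_eq_of_L1, hTa]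
      refine (norm_sum_le _ _).trans (Finset.sum_le_sum fun j _ => ?_)
      rw [norm_smul]
      exact mul_le_of_le_one_right (norm_nonneg _) (hvn j)
  have h2 := DecP.smul (∏ i, ‖w i‖) h1
  rw [← MultilinearMap.map_smul_univ, ← hwv, abs_of_nonneg (by positivity)] at h2
  exact h2

theorem dec_signed {P : Set E} (hP : IsGenCone P) {n : ℕ} {κ : ℝ}
    (hκ : DecP (l1cone n) n (symM _ n (l1e n)) κ) (w : Fin n → E)
    (hw : ∀ i, w i ∈ P ∨ - w i ∈ P) :
    DecP P n (symM E n w) ((∏ i, ‖w i‖) * κ) := by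
  have : ∀ i, ∃ c : ℝ, |c| = 1 ∧ ∃ u ∈ P, w i = c • u ∧ ‖u‖ = ‖w i‖ := by
    intro i
    rcases hw i with h | h
    · exact ⟨1, by simp, w i, h, by simp, rfl⟩
    · exact ⟨-1, by simp, -w i, h, by simp, by simp⟩
  choose c hc u hu hwu hn using this
  have h := DecP.smul (∏ i, c i) (dec_pos hP hκ u hu)
  rw [← MultilinearMap.map_smul_univ, Finset.abs_prod, Finset.prod_congr rfl (fun i _ => hc i),
    Finset.prod_const_one, one_mul, Finset.prod_congr rfl (fun i _ => hn i)] at h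
  have e : w = fun i => c i • u i := funext hwu
  rw [← e] at h
  exact h

theorem dec_gen {P : Set E} (hP : IsGenCone P) {n : ℕ} {κ : ℝ} (hκ0 : 0 ≤ κ)
    (hκ : DecP (l1cone n) n (symM _ n (l1e n)) κ) {C : ℝ}
    (hC : ∀ x : E, ∃ y ∈ P, ∃ z ∈ P, x = y - z ∧ ‖y‖ + ‖z‖ ≤ C * ‖x‖) (x : Fin n → E) :
    DecP P n (symM E n x) (κ * C ^ n * ∏ i, ‖x i‖) := by
  classical
  choose y hy z hz hxyz hn using hC
  have e : x = (fun i => y (x i)) + (fun i => - z (x i)) := by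
    funext i
    simpa [sub_eq_add_neg] using hxyz (x i)
  have h : DecP P n (symM E n x) (∑ s : Finset (Fin n),
      (∏ i, ‖s.piecewise (fun i => y (x i)) (fun i => - z (x i)) i‖) * κ) := by
    conv => arg 3; rw [e]
    rw [MultilinearMap.map_add_univ]
    refine DecP.sum _ _ _ fun s _ => dec_signed hP hκ _ fun i => ?_
    by_cases hi : i ∈ s
    · left; simpa [hi] using hy _
    · right; simpa [hi] using hz _
  refine h.mono ?_
  have e2 : ∑ s : Finset (Fin n),
      (∏ i, ‖s.piecewise (fun i => y (x i)) (fun i => - z (x i)) i‖) * κ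
      = (∏ i, (‖y (x i)‖ + ‖z (x i)‖)) * κ := by
    rw [Fintype.prod_add, Finset.sum_mul]
    refine Finset.sum_congr rfl fun s _ => ?_
    rw [← Finset.prod_mul_prod_compl s]
    congr 2
    · exact Finset.prod_congr rfl fun i hi => by simp [hi]
    · exact Finset.prod_congr rfl fun i hi => by simp [Finset.mem_compl.1 hi]
  rw [e2]
  calc (∏ i, (‖y (x i)‖ + ‖z (x i)‖)) * κ ≤ (∏ i, (C * ‖x i‖)) * κ := by
        refine mul_le_mul_of_nonneg_right ?_ hκ0
        exact Finset.prod_le_prod (fun i _ => by positivity) fun i _ => hn _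
    _ = κ * C ^ n * ∏ i, ‖x i‖ := by
        rw [Finset.prod_mul_distrib]; simp; ring

theorem normPlus_le {P : Set E} {y z : E} (hy : y ∈ P) (hz : z ∈ P) :
    normPlus P (y - z) ≤ ‖y‖ + ‖z‖ := by
  refine csInf_le ⟨0, ?_⟩ ⟨y, hy, z, hz, rfl, rfl⟩
  rintro _ ⟨y, -, z, -, -, rfl⟩
  positivity

theorem normPlus_nonneg (P : Set E) (x : E) : 0 ≤ normPlus P x := by
  apply Real.sInf_nonneg
  rintro _ ⟨y, -, z, -, -, rfl⟩
  positivity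

theorem cPlus_nonneg (P : Set E) : 0 ≤ cPlus P := by
  apply Real.sSup_nonneg
  rintro _ ⟨x, -, rfl⟩
  exact normPlus_nonneg P x

theorem exists_split {P : Set E} (hP : IsGenCone P) (hf : CPlusFinite P) {C : ℝ}
    (hC : cPlus P < C) (x : E) : ∃ y ∈ P, ∃ z ∈ P, x = y - z ∧ ‖y‖ + ‖z‖ ≤ C * ‖x‖ := by
  obtain ⟨-, hadd, hsm, hgen⟩ := hP
  have h0 : (0 : E) ∈ P := by
    obtain ⟨y, hy, -⟩ := hgen 0
    simpa using hsm 0 le_rfl y hy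
  by_cases hx : x = 0
  · exact ⟨0, h0, 0, h0, by simp [hx], by simp [hx]⟩
  have hx' := norm_ne_zero_iff.2 hx
  have h1 : normPlus P (‖x‖⁻¹ • x) < C := by
    refine lt_of_le_of_lt (le_csSup hf ⟨_, ?_, rfl⟩) hC
    rw [norm_smul, norm_inv, norm_norm, inv_mul_cancel₀ hx']
  obtain ⟨y0, hy0, z0, hz0, e0⟩ := hgen (‖x‖⁻¹ • x)
  obtain ⟨_, ⟨y, hy, z, hz, e, rfl⟩, hlt⟩ :=
    exists_lt_of_csInf_lt (s := {r : ℝ | ∃ y ∈ P, ∃ z ∈ P, ‖x‖⁻¹ • x = y - z ∧ r = ‖y‖ + ‖z‖})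
      ⟨_, y0, hy0, z0, hz0, e0, rfl⟩ h1
  refine ⟨‖x‖ • y, hsm _ (norm_nonneg _) _ hy, ‖x‖ • z, hsm _ (norm_nonneg _) _ hz, ?_, ?_⟩
  · rw [← smul_sub, ← e, smul_smul, mul_inv_cancel₀ hx', one_smul]
  · rw [norm_smul, norm_smul, norm_norm, ← mul_add, mul_comm]
    exact mul_le_mul_of_nonneg_right hlt.le (norm_nonneg _)

theorem lift_symM_span {n : ℕ} {t : ⨂[ℝ] (_ : Fin n), E} (ht : t ∈ Submodule.span ℝ
      {u : ⨂[ℝ] (_ : Fin n), E | ∃ x : E, u = ⨂ₜ[ℝ] (_ : Fin n), x}) :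
    PiTensorProduct.lift (symM E n) t = t := by
  induction ht using Submodule.span_induction with
  | mem u hu =>
    obtain ⟨x, rfl⟩ := hu
    rw [PiTensorProduct.lift.tprod, symM_const]
  | zero => simp
  | add u v _ _ hu hv => rw [map_add, hu, hv]
  | smul c u _ hu => rw [map_smul, hu]

theorem span_dec {n : ℕ} {t : ⨂[ℝ] (_ : Fin n), E} (ht : t ∈ Submodule.span ℝ
      {u : ⨂[ℝ] (_ : Fin n), E | ∃ x : E, u = ⨂ₜ[ℝ] (_ : Fin n), x}) :
    ∃ (N : ℕ) (a : Fin N → ℝ) (x : Fin N → Fin n → E), t = ∑ k, a k • (⨂ₜ[ℝ] i, x k i) := by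
  have : ∃ s, DecP (Set.univ : Set E) n t s := by
    induction ht using Submodule.span_induction with
    | mem u hu =>
      obtain ⟨x, rfl⟩ := hu
      exact ⟨_, DecP.pow (Set.mem_univ x)⟩
    | zero => exact ⟨_, DecP.zero _ _⟩
    | add u v _ _ hu hv =>
      obtain ⟨s, hs⟩ := hu
      obtain ⟨s', hs'⟩ := hv
      exact ⟨_, hs.add hs'⟩
    | smul c u _ hu =>
      obtain ⟨s, hs⟩ := hu
      exact ⟨_, hs.smul c⟩
  obtain ⟨s, N, a, x, -, h, -⟩ := this
  exact ⟨N, a, fun k _ => x k, h⟩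

theorem main_ineq {P : Set E} (hP : IsGenCone P) (hf : CPlusFinite P) {n : ℕ}
    (t : ⨂[ℝ] (_ : Fin n), E) (ht : t ∈ Submodule.span ℝ
      {u : ⨂[ℝ] (_ : Fin n), E | ∃ x : E, u = ⨂ₜ[ℝ] (_ : Fin n), x}) :
    symProjNormPos P n t ≤ kappa n * cPlus P ^ n * projNorm n t := by
  -- bound for each choice
  have key : ∀ κ, DecP (l1cone n) n (symM _ n (l1e n)) κ → ∀ C, cPlus P < C →
      ∀ (N : ℕ) (a : Fin N → ℝ) (x : Fin N → Fin n → E), t = ∑ k, a k • (⨂ₜ[ℝ] i, x k i) →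
      symProjNormPos P n t ≤ κ * C ^ n * ∑ k, |a k| * ∏ i, ‖x k i‖ := by
    intro κ hκ C hC N a x h
    have hκ0 : 0 ≤ κ := (symPos_nonneg _ _ _).trans hκ.norm_le
    have e : t = ∑ k, a k • symM E n (x k) := by
      rw [← lift_symM_span ht, h]
      simp [PiTensorProduct.lift.tprod]
    have hd : DecP P n t (∑ k, |a k| * (κ * C ^ n * ∏ i, ‖x k i‖)) := by
      rw [e]
      exact DecP.sum _ _ _ fun k _ => DecP.smul _ (dec_gen hP hκ0 hκ (exists_split hP hf hC) _)
    refine hd.norm_le.trans (le_of_eq ?_)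
    rw [Finset.mul_sum]
    exact Finset.sum_congr rfl fun k _ => by ring
  obtain ⟨κ0, hκ0⟩ := kappa_dec n
  -- limit in C
  have key2 : ∀ κ, DecP (l1cone n) n (symM _ n (l1e n)) κ →
      ∀ (N : ℕ) (a : Fin N → ℝ) (x : Fin N → Fin n → E), t = ∑ k, a k • (⨂ₜ[ℝ] i, x k i) →
      symProjNormPos P n t ≤ κ * cPlus P ^ n * ∑ k, |a k| * ∏ i, ‖x k i‖ := by
    intro κ hκ N a x h
    have hc : Filter.Tendsto (fun C : ℝ => κ * C ^ n * ∑ k, |a k| * ∏ i, ‖x k i‖)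
        (nhdsWithin (cPlus P) (Set.Ioi (cPlus P)))
        (nhds (κ * cPlus P ^ n * ∑ k, |a k| * ∏ i, ‖x k i‖)) := by
      refine Filter.Tendsto.mono_left ?_ nhdsWithin_le_nhds
      exact Continuous.tendsto (by fun_prop) _
    refine ge_of_tendsto hc ?_
    filter_upwards [self_mem_nhdsWithin] with C hC
    exact key κ hκ C hC N a x h
  -- infimum over kappa
  have key3 : ∀ (N : ℕ) (a : Fin N → ℝ) (x : Fin N → Fin n → E),
      t = ∑ k, a k • (⨂ₜ[ℝ] i, x k i) →
      symProjNormPos P n t ≤ kappa n * cPlus P ^ n * ∑ k, |a k| * ∏ i, ‖x k i‖ := by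
    intro N a x h
    have hnn : 0 ≤ cPlus P ^ n * ∑ k, |a k| * ∏ i, ‖x k i‖ :=
      mul_nonneg (pow_nonneg (cPlus_nonneg P) _) (Finset.sum_nonneg fun k _ =>
        mul_nonneg (abs_nonneg _) (Finset.prod_nonneg fun _ _ => norm_nonneg _))
    rw [mul_assoc]
    rcases hnn.eq_or_lt with h0 | h0
    · have := key2 κ0 hκ0 N a x h
      rw [mul_assoc, ← h0] at this
      rw [← h0]; simpa using this
    · rw [← div_le_iff₀ h0, kappa_eq]
      refine le_symPos hκ0 fun r hr => ?_
      rw [div_le_iff₀ h0, ← mul_assoc]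
      exact key2 r hr N a x h
  obtain ⟨N0, a0, x0, h0⟩ := span_dec ht
  have hnn : 0 ≤ kappa n * cPlus P ^ n :=
    mul_nonneg (kappa_pos n).le (pow_nonneg (cPlus_nonneg P) _)
  rcases hnn.eq_or_lt with hz | hz
  · have := key3 N0 a0 x0 h0
    rw [← hz] at this ⊢
    simpa using this
  · rw [← div_le_iff₀' hz]
    refine le_csInf ⟨_, N0, a0, x0, h0, rfl⟩ ?_
    rintro _ ⟨N, a, x, h, rfl⟩
    rw [div_le_iff₀' hz]
    exact key3 N a x h

/-- Properties of an `ℓ₁`-like ordered space of dimension at least `n`. -/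
structure L1Like (P : Set E) (n : ℕ) : Prop where
  cone : IsGenCone P
  fin : CPlusFinite P
  one : cPlus P ≤ 1
  ex : ∃ (b : Fin n → E) (Q : E →ₗ[ℝ] PiLp 1 fun _ : Fin n => ℝ), (∀ i, b i ∈ P) ∧
    (∀ i, ‖b i‖ ≤ 1) ∧ (∀ x ∈ P, Q x ∈ l1cone n) ∧ (∀ x ∈ P, ‖Q x‖ ≤ ‖x‖) ∧
    ∀ i, Q (b i) = l1e n i

theorem L1Like.mk' {P : Set E} {n : ℕ} (hcl : IsClosed P) (hadd : ∀ x ∈ P, ∀ y ∈ P, x + y ∈ P)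
    (hsm : ∀ (c : ℝ), 0 ≤ c → ∀ x ∈ P, c • x ∈ P)
    (hs : ∀ x : E, ∃ y ∈ P, ∃ z ∈ P, x = y - z ∧ ‖y‖ + ‖z‖ ≤ ‖x‖)
    (ex : ∃ (b : Fin n → E) (Q : E →ₗ[ℝ] PiLp 1 fun _ : Fin n => ℝ), (∀ i, b i ∈ P) ∧
    (∀ i, ‖b i‖ ≤ 1) ∧ (∀ x ∈ P, Q x ∈ l1cone n) ∧ (∀ x ∈ P, ‖Q x‖ ≤ ‖x‖) ∧
    ∀ i, Q (b i) = l1e n i) : L1Like P n := by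
  have hb : ∀ r ∈ {r : ℝ | ∃ x : E, ‖x‖ ≤ 1 ∧ r = normPlus P x}, r ≤ 1 := by
    rintro _ ⟨x, hx, rfl⟩
    obtain ⟨y, hy, z, hz, rfl, h⟩ := hs x
    exact (normPlus_le hy hz).trans (h.trans hx)
  refine ⟨⟨hcl, hadd, hsm, fun x => ?_⟩, ⟨1, hb⟩, Real.sSup_le hb zero_le_one, ex⟩
  obtain ⟨y, hy, z, hz, h, -⟩ := hs x
  exact ⟨y, hy, z, hz, h⟩

theorem L1Like.wit {P : Set E} {n : ℕ} (h : L1Like P n) : ∃ t : ⨂[ℝ] (_ : Fin n), E,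
    t ∈ Submodule.span ℝ
      {u : ⨂[ℝ] (_ : Fin n), E | ∃ x : E, u = ⨂ₜ[ℝ] (_ : Fin n), x} ∧
    kappa n ≤ symProjNormPos P n t ∧ projNorm n t ≤ 1 := by
  obtain ⟨b, Q, hb, hbn, hQ, hQn, hQb⟩ := h.ex
  obtain ⟨κ0, hκ0⟩ := kappa_dec n
  have hd := dec_pos h.cone hκ0 b hb
  refine ⟨symM E n b, hd.mem_span, ?_, ?_⟩
  · refine le_symPos hd fun r hr => ?_
    have := hr.map Q hQ hQn
    rw [map_symM] at this
    simp only [hQb] at this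
    rw [kappa_eq]
    exact this.norm_le
  · have hN : Fintype.card (Equiv.Perm (Fin n)) = n.factorial := by
      rw [Fintype.card_perm, Fintype.card_fin]
    let e : Fin n.factorial ≃ Equiv.Perm (Fin n) := (Fintype.equivFinOfCardEq hN).symm
    have hmem : projNorm n (symM E n b) ≤ ∑ k : Fin n.factorial, |(n.factorial : ℝ)⁻¹| *
        ∏ i, ‖b (e k i)‖ := by
      refine csInf_le ⟨0, ?_⟩ ⟨n.factorial, fun _ => (n.factorial : ℝ)⁻¹,
        fun k i => b (e k i), ?_, rfl⟩
      · rintro _ ⟨N, a, x, -, rfl⟩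
        exact Finset.sum_nonneg fun k _ => mul_nonneg (abs_nonneg _)
          (Finset.prod_nonneg fun _ _ => norm_nonneg _)
      · rw [symM_apply, ← Finset.smul_sum]
        congr 1
        exact (Equiv.sum_comp e (fun σ : Equiv.Perm (Fin n) => ⨂ₜ[ℝ] i, b (σ i))).symm
    refine hmem.trans ?_
    have hfp : (0 : ℝ) < n.factorial := by exact_mod_cast n.factorial_pos
    calc _ ≤ ∑ k : Fin n.factorial, |(n.factorial : ℝ)⁻¹| * 1 := by
          refine Finset.sum_le_sum fun k _ => mul_le_mul_of_nonneg_left ?_ (abs_nonneg _)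
          exact Finset.prod_le_one (fun _ _ => norm_nonneg _) fun i _ => hbn _
      _ = 1 := by
          rw [abs_of_pos (inv_pos.2 hfp)]
          simp [hfp.ne']

theorem L1Like.cs_eq {P : Set E} {n : ℕ} (h : L1Like P n) : csPlus E P n = kappa n := by
  have hup : ∀ t : ⨂[ℝ] (_ : Fin n), E, t ∈ Submodule.span ℝ
      {u : ⨂[ℝ] (_ : Fin n), E | ∃ x : E, u = ⨂ₜ[ℝ] (_ : Fin n), x} →
      symProjNormPos P n t ≤ kappa n * projNorm n t := by
    intro t ht
    refine (main_ineq h.cone h.fin t ht).trans ?_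
    refine mul_le_mul_of_nonneg_right ?_ (projNorm_nonneg' n t)
    exact mul_le_of_le_one_right (kappa_pos n).le (pow_le_one₀ (cPlus_nonneg P) h.one)
  have hb : ∀ r ∈ {r : ℝ | ∃ t : ⨂[ℝ] (_ : Fin n), E,
    t ∈ Submodule.span ℝ {u : ⨂[ℝ] (_ : Fin n), E | ∃ x : E, u = ⨂ₜ[ℝ] (_ : Fin n), x} ∧
    t ≠ 0 ∧ r = symProjNormPos P n t / projNorm n t}, r ≤ kappa n := by
    rintro _ ⟨t, ht, -, rfl⟩
    exact div_le_of_le_mul₀ (projNorm_nonneg' n t) (kappa_pos n).le (hup t ht)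
  refine le_antisymm (Real.sSup_le hb (kappa_pos n).le) ?_
  obtain ⟨t, ht, h1, h2⟩ := h.wit
  have hpos : 0 < projNorm n t := by
    have := (kappa_pos n).trans_le (h1.trans (hup t ht))
    exact pos_of_mul_pos_right this (kappa_pos n).le
  have ht0 : t ≠ 0 := by
    rintro rfl
    have := (kappa_pos n).trans_le (h1.trans (DecP.zero P n).norm_le)
    exact lt_irrefl _ this
  refine le_trans ?_ (le_csSup ⟨_, hb⟩ ⟨t, ht, ht0, rfl⟩)
  rw [le_div_iff₀ hpos]
  exact (mul_le_of_le_one_right (kappa_pos n).le h2).trans h1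

theorem L1Like.smallest {P : Set E} {n : ℕ} (h : L1Like P n) (K : ℝ)
    (hK : ∀ t : ⨂[ℝ] (_ : Fin n), E, t ∈ Submodule.span ℝ
      {u : ⨂[ℝ] (_ : Fin n), E | ∃ x : E, u = ⨂ₜ[ℝ] (_ : Fin n), x} →
      symProjNormPos P n t ≤ K * cPlus P ^ n * projNorm n t) : kappa n ≤ K := by
  obtain ⟨t, ht, h1, h2⟩ := h.wit
  have h3 := h1.trans (hK t ht)
  have h4 : 0 ≤ cPlus P ^ n * projNorm n t :=
    mul_nonneg (pow_nonneg (cPlus_nonneg P) n) (projNorm_nonneg' n t)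
  have h5 : cPlus P ^ n * projNorm n t ≤ 1 :=
    mul_le_one₀ (pow_le_one₀ (cPlus_nonneg P) h.one) (projNorm_nonneg' n t) h2
  have := kappa_pos n
  rw [mul_assoc] at h3
  by_cases hK0 : 0 ≤ K
  · exact h3.trans (mul_le_of_le_one_right hK0 h5)
  · nlinarith

end aux

theorem l1like_pi (n m : ℕ) (hnm : n ≤ m) : L1Like (l1cone m) n := by
  refine L1Like.mk' ?_ ?_ ?_ ?_ ?_
  · have : l1cone m = ⋂ i, {x : PiLp 1 fun _ : Fin m => ℝ | 0 ≤ x i} := by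
      ext x; simp [l1cone]
    rw [this]
    exact isClosed_iInter fun i => isClosed_le continuous_const (by fun_prop)
  · intro x hx y hy i
    exact add_nonneg (hx i) (hy i)
  · intro c hc x hx i
    exact mul_nonneg hc (hx i)
  · intro x
    refine ⟨WithLp.toLp 1 fun i => max (x i) 0, fun i => le_max_right _ _,
      WithLp.toLp 1 fun i => max (-x i) 0, fun i => le_max_right _ _, ?_, ?_⟩
    · ext i
      simp only [PiLp.sub_apply]
      rcases le_total 0 (x i) with h | h <;> simp [h]
    · simp only [PiLp.norm_eq_of_L1, ← Finset.sum_add_distrib]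
      refine Finset.sum_le_sum fun i _ => ?_
      rcases le_total 0 (x i) with h | h <;> simp [h]
  · refine ⟨fun i => l1e m (Fin.castLE hnm i),
      { toFun := fun x => WithLp.toLp 1 fun i => x (Fin.castLE hnm i)
        map_add' := fun x y => by ext i; simp
        map_smul' := fun c x => by ext i; simp }, fun i => l1e_mem _ _,
        fun i => (norm_l1e _ _).le, fun x hx i => hx _, fun x _ => ?_, fun i => ?_⟩
    · simp only [PiLp.norm_eq_of_L1, LinearMap.coe_mk, AddHom.coe_mk]
      refine (Finset.sum_map Finset.univ (Fin.castLEEmb hnm) (fun j => ‖x j‖)).symm.le.trans ?_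
      exact Finset.sum_le_sum_of_subset_of_nonneg (Finset.subset_univ _) fun _ _ _ => norm_nonneg _
    · ext j
      simp [l1e_apply]

theorem l1_hasSum (x : lp (fun _ : ℕ => ℝ) 1) : HasSum (fun i => ‖x i‖) ‖x‖ := by
  simpa using lp.hasSum_norm (p := 1) (by simp) x

theorem l1_mk (f : ℕ → ℝ) (x : lp (fun _ : ℕ => ℝ) 1) (h : ∀ i, ‖f i‖ ≤ ‖x i‖) :
    Memℓp f 1 := by
  refine memℓp_gen ?_
  simp only [ENNReal.toReal_one, Real.rpow_one]
  exact Summable.of_nonneg_of_le (fun _ => norm_nonneg _) h (l1_hasSum x).summable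

theorem l1like_lp (n : ℕ) : L1Like {x : lp (fun _ : ℕ => ℝ) 1 | ∀ i, 0 ≤ x i} n := by
  refine L1Like.mk' ?_ ?_ ?_ ?_ ?_
  · have : {x : lp (fun _ : ℕ => ℝ) 1 | ∀ i, 0 ≤ x i}
        = ⋂ i, {x : lp (fun _ : ℕ => ℝ) 1 | 0 ≤ x i} := by
      ext x; simp
    rw [this]
    refine isClosed_iInter fun i => isClosed_le continuous_const ?_
    exact (continuous_apply i).comp (lp.uniformContinuous_coe (p := 1)).continuous
  · intro x hx y hy i
    exact add_nonneg (hx i) (hy i)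
  · intro c hc x hx i
    exact mul_nonneg hc (hx i)
  · intro x
    let y : lp (fun _ : ℕ => ℝ) 1 := ⟨fun i => max (x i) 0, l1_mk _ x fun i => by
      rcases le_total 0 (x i) with h | h <;> simp [h]⟩
    let z : lp (fun _ : ℕ => ℝ) 1 := ⟨fun i => max (-x i) 0, l1_mk _ x fun i => by
      rcases le_total 0 (x i) with h | h <;> simp [h]⟩
    have hy : ∀ i, y i = max (x i) 0 := fun i => rfl
    have hz : ∀ i, z i = max (-x i) 0 := fun i => rfl
    refine ⟨y, fun i => le_max_right _ _, z, fun i => le_max_right _ _, ?_, ?_⟩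
    · ext i
      simp only [lp.coeFn_sub, Pi.sub_apply, hy, hz]
      rcases le_total 0 (x i) with h | h <;> simp [h]
    · refine hasSum_le (fun i => ?_) ((l1_hasSum y).add (l1_hasSum z)) (l1_hasSum x)
      simp only [hy, hz]
      rcases le_total 0 (x i) with h | h <;> simp [h]
  · refine ⟨fun i => lp.single 1 (i : ℕ) (1 : ℝ),
      { toFun := fun x => WithLp.toLp 1 fun i => x (i : ℕ)
        map_add' := fun x y => by ext i; simp
        map_smul' := fun c x => by ext i; simp }, fun i j => ?_,
        fun i => ?_, fun x hx i => hx _, fun x _ => ?_, fun i => ?_⟩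
    · rw [lp.single_apply, Pi.single_apply]
      split_ifs <;> simp
    · rw [lp.norm_single (by simp)]
      simp
    · simp only [PiLp.norm_eq_of_L1, LinearMap.coe_mk, AddHom.coe_mk]
      rw [Fin.sum_univ_eq_sum_range (fun i => ‖x i‖)]
      exact sum_le_hasSum _ (fun _ _ => norm_nonneg _) (l1_hasSum x)
    · ext j
      simp [l1e_apply, Pi.single_apply, Fin.ext_iff]

theorem l1like_ulift.{u} (n : ℕ) :
    L1Like {x : ULift.{u} (PiLp 1 fun _ : Fin n => ℝ) | x.down ∈ l1cone n} n := by
  obtain ⟨⟨h1, h2, h3, -⟩, -, -, b, Q, hb, hbn, hQ, hQn, hQb⟩ := l1like_pi n n le_rfl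
  refine L1Like.mk' ?_ ?_ ?_ ?_ ?_
  · exact h1.preimage continuous_uliftDown
  · intro x hx y hy
    exact h2 _ hx _ hy
  · intro c hc x hx
    exact h3 c hc _ hx
  · intro x
    refine ⟨⟨WithLp.toLp 1 fun i => max (x.down i) 0⟩, fun i => le_max_right _ _,
      ⟨WithLp.toLp 1 fun i => max (-x.down i) 0⟩, fun i => le_max_right _ _, ?_, ?_⟩
    · apply ULift.ext
      ext i
      simp only [ULift.sub_down, PiLp.sub_apply]
      rcases le_total 0 (x.down i) with h | h <;> simp [h]
    · simp only [ULift.norm_def, PiLp.norm_eq_of_L1, ← Finset.sum_add_distrib]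
      refine Finset.sum_le_sum fun i _ => ?_
      rcases le_total 0 (x.down i) with h | h <;> simp [h]
  · exact ⟨fun i => ⟨b i⟩, Q.comp (ULift.moduleEquiv : ULift.{u} (PiLp 1 fun _ : Fin n => ℝ) ≃ₗ[ℝ] _).toLinearMap,
      hb, hbn, fun x hx => hQ _ hx, fun x hx => hQn _ hx, hQb⟩

/-- For `n ≤ m ≤ ∞`, `c_{s+}(n, ℓ₁^m) = κ(n)`; moreover for every ordered normed space `E`
and every symmetric tensor `𝐱 ∈ E^∨n` one has `‖𝐱‖_{πs+} ≤ κ(n)·c₊(E)ⁿ·‖𝐱‖_π`, and `κ(n)`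
is the smallest constant with this property, i.e. `sup_E c_{s+}(n,E)/c₊(E)ⁿ = κ(n)`. -/
theorem csPlus_l1_eq_kappa (n : ℕ) (hn : 1 ≤ n) :
    (∀ m : ℕ, n ≤ m → csPlus (PiLp 1 fun _ : Fin m => ℝ) (l1cone m) n = kappa n) ∧
      csPlus (lp (fun _ : ℕ => ℝ) 1) {x | ∀ i, 0 ≤ x i} n = kappa n ∧
      (∀ (E : Type*) [NormedAddCommGroup E] [NormedSpace ℝ E] (P : Set E),
        IsGenCone P → CPlusFinite P →
        ∀ t : ⨂[ℝ] (_ : Fin n), E,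
          t ∈ Submodule.span ℝ
            {u : ⨂[ℝ] (_ : Fin n), E | ∃ x : E, u = ⨂ₜ[ℝ] (_ : Fin n), x} →
          symProjNormPos P n t ≤ kappa n * cPlus P ^ n * projNorm n t) ∧
      ∀ K : ℝ,
        (∀ (E : Type*) [NormedAddCommGroup E] [NormedSpace ℝ E] (P : Set E),
          IsGenCone P → CPlusFinite P →
          ∀ t : ⨂[ℝ] (_ : Fin n), E,
            t ∈ Submodule.span ℝ
              {u : ⨂[ℝ] (_ : Fin n), E | ∃ x : E, u = ⨂ₜ[ℝ] (_ : Fin n), x} →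
            symProjNormPos P n t ≤ K * cPlus P ^ n * projNorm n t) →
        kappa n ≤ K := by
  refine ⟨fun m hm => (l1like_pi n m hm).cs_eq, (l1like_lp n).cs_eq, ?_, ?_⟩
  · intro E _ _ P hP hf t ht
    exact main_ineq hP hf t ht
  · intro K hK
    exact (l1like_ulift n).smallest K (hK _ _ (l1like_ulift n).cone (l1like_ulift n).fin)

end
end

section
/- In ℓ₁², the positive symmetric projective norm of the symmetrized tensor e₁∨e₂ = (e₁⊗e₂ + e₂⊗e₁)/2 equals 3; i.e., κ(2) = ‖e₁∨e₂‖_{πs+} = 3. -/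
open scoped BigOperators TensorProduct
open PiTensorProduct

noncomputable section

/-- Coordinate functional. -/
def auxc (i : Fin 2) : (PiLp 1 fun _ : Fin 2 => ℝ) →ₗ[ℝ] ℝ where
  toFun x := x i
  map_add' _ _ := rfl
  map_smul' _ _ := rfl

/-- Product of coordinates as a functional on the tensor square. -/
def auxphi (i j : Fin 2) : (⨂[ℝ] (_ : Fin 2), (PiLp 1 fun _ : Fin 2 => ℝ)) →ₗ[ℝ] ℝ :=
  PiTensorProduct.lift
    ((MultilinearMap.mkPiAlgebra ℝ (Fin 2) ℝ).compLinearMap (fun k => auxc (![i, j] k)))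

theorem auxphi_tprod (i j : Fin 2) (x : Fin 2 → PiLp 1 fun _ : Fin 2 => ℝ) :
    auxphi i j (⨂ₜ[ℝ] k, x k) = x 0 i * x 1 j := by
  simp [auxphi, auxc, Fin.prod_univ_two]

/-- The dual functional. -/
def auxL : (⨂[ℝ] (_ : Fin 2), (PiLp 1 fun _ : Fin 2 => ℝ)) →ₗ[ℝ] ℝ :=
  (3 : ℝ) • auxphi 0 1 + (3 : ℝ) • auxphi 1 0 - auxphi 0 0 - auxphi 1 1

theorem auxL_tprod (x : Fin 2 → PiLp 1 fun _ : Fin 2 => ℝ) :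
    auxL (⨂ₜ[ℝ] k, x k) =
      3 * (x 0 0 * x 1 1) + 3 * (x 0 1 * x 1 0) - x 0 0 * x 1 0 - x 0 1 * x 1 1 := by
  simp [auxL, auxphi_tprod]

theorem aux_norm (x : PiLp 1 fun _ : Fin 2 => ℝ) : ‖x‖ = |x 0| + |x 1| := by
  rw [PiLp.norm_eq_of_nat (p := 1) 1 (by norm_num)]
  simp [Fin.sum_univ_two]

theorem aux_add (x y : PiLp 1 fun _ : Fin 2 => ℝ) :
    (⨂ₜ[ℝ] (_ : Fin 2), (x + y)) = (⨂ₜ[ℝ] (_ : Fin 2), x) + (⨂ₜ[ℝ] (_ : Fin 2), y)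
      + ((⨂ₜ[ℝ] i, ![x, y] i) + ⨂ₜ[ℝ] i, ![y, x] i) := by
  have h0 : ∀ a b c : PiLp 1 fun _ : Fin 2 => ℝ,
      tprod ℝ ![a + b, c] = tprod ℝ ![a, c] + tprod ℝ ![b, c] := by
    intro a b c
    have := (tprod ℝ (s := fun _ : Fin 2 => PiLp 1 fun _ : Fin 2 => ℝ)).map_update_add
      ![a, c] 0 a b
    have hu : ∀ z, Function.update ![a, c] 0 z = ![z, c] := by
      intro z; ext i; fin_cases i <;> simp
    rw [hu, hu, hu] at this
    exact this
  have h1 : ∀ a b c : PiLp 1 fun _ : Fin 2 => ℝ,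
      tprod ℝ ![c, a + b] = tprod ℝ ![c, a] + tprod ℝ ![c, b] := by
    intro a b c
    have := (tprod ℝ (s := fun _ : Fin 2 => PiLp 1 fun _ : Fin 2 => ℝ)).map_update_add
      ![c, a] 1 a b
    have hu : ∀ z, Function.update ![c, a] 1 z = ![c, z] := by
      intro z; ext i; fin_cases i <;> simp
    rw [hu, hu, hu] at this
    exact this
  have h2 : ∀ z : PiLp 1 fun _ : Fin 2 => ℝ, (fun _ : Fin 2 => z) = ![z, z] := by
    intro z; ext i; fin_cases i <;> simp
  rw [h2, h2, h2]
  change tprod ℝ ![x + y, x + y] = tprod ℝ ![x, x] + tprod ℝ ![y, y]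
    + (tprod ℝ ![x, y] + tprod ℝ ![y, x])
  rw [h0, h1, h1]
  abel

theorem aux_main :
    symProjNormPos (l1cone 2) 2
        ((2 : ℝ)⁻¹ • ((⨂ₜ[ℝ] i, ![l1e 2 0, l1e 2 1] i) + ⨂ₜ[ℝ] i, ![l1e 2 1, l1e 2 0] i))
      = 3 := by
  unfold symProjNormPos
  refine IsLeast.csInf_eq ⟨?_, ?_⟩
  · refine ⟨3, ![2⁻¹, -2⁻¹, -2⁻¹], ![l1e 2 0 + l1e 2 1, l1e 2 0, l1e 2 1], ?_, ?_, ?_⟩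
    · intro k i
      fin_cases k <;> fin_cases i <;> simp [l1e]
    · simp only [Fin.sum_univ_three, Matrix.cons_val]
      rw [aux_add]
      module
    · simp [Fin.sum_univ_three, aux_norm, l1e]
      norm_num [abs_of_pos]
  · rintro s ⟨N, a, x, hx, ht, rfl⟩
    have h := congrArg auxL ht
    rw [map_smul, map_add, auxL_tprod, auxL_tprod, map_sum] at h
    simp only [map_smul, auxL_tprod] at h
    have h3 : (3 : ℝ) = ∑ k, a k • (3 * (x k 0 * x k 1) + 3 * (x k 1 * x k 0)
        - x k 0 * x k 0 - x k 1 * x k 1) := by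
      rw [← h]; simp [l1e]; norm_num
    rw [h3]
    refine Finset.sum_le_sum fun k _ => ?_
    have p0 : 0 ≤ x k 0 := hx k 0
    have p1 : 0 ≤ x k 1 := hx k 1
    rw [aux_norm, abs_of_nonneg p0, abs_of_nonneg p1, smul_eq_mul]
    refine (le_abs_self _).trans ?_
    rw [abs_mul]
    refine mul_le_mul_of_nonneg_left ?_ (abs_nonneg _)
    rw [abs_le]
    constructor <;> nlinarith [mul_nonneg p0 p1, sq_nonneg (x k 0 - x k 1)]

/-- In `ℓ₁²`, `κ(2) = ‖e₁ ∨ e₂‖_{πs+} = ‖(e₁⊗e₂ + e₂⊗e₁)/2‖_{πs+} = 3`. -/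
theorem kappa_two :
    symProjNormPos (l1cone 2) 2
        ((2 : ℝ)⁻¹ • ((⨂ₜ[ℝ] i, ![l1e 2 0, l1e 2 1] i) + ⨂ₜ[ℝ] i, ![l1e 2 1, l1e 2 0] i)) = 3 ∧
      kappa 2 = 3 := by
  refine ⟨aux_main, ?_⟩
  rw [← aux_main]
  unfold kappa
  congr 1
  have hs : (Finset.univ : Finset (Equiv.Perm (Fin 2))) = {1, Equiv.swap 0 1} := by decide
  have hne : (1 : Equiv.Perm (Fin 2)) ≠ Equiv.swap 0 1 := by decide
  rw [hs, Finset.sum_pair hne]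
  have e1 : (fun i => l1e 2 ((1 : Equiv.Perm (Fin 2)) i)) = ![l1e 2 0, l1e 2 1] := by
    ext i; fin_cases i <;> simp
  have e2 : (fun i => l1e 2 ((Equiv.swap 0 1 : Equiv.Perm (Fin 2)) i))
      = ![l1e 2 1, l1e 2 0] := by
    ext i; fin_cases i <;> simp
  rw [e1, e2]
  simp [Nat.factorial]

end
end

section
/- Let n ≥ m ≥ 1 and let n₁,…,n_m be positive integers with n₁ + ⋯ + n_m = n. Then for every t ∈ [0,1], Σ_{k=1}^m Σ_{i=0}^{n_k−1} log(1 − t·i/n_k) − Σ_{i=0}^{n−1} log(1 − t·i/n) ≥ (m−1)·t/2. -/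
open scoped BigOperators

lemma aux_mono (f : ℝ → ℝ) (hf : ∀ x y, 0 ≤ x → x ≤ y → y < 1 → f x ≤ f y) (h0 : f 0 = 0)
    (a b : ℕ) :
    ∑ i ∈ Finset.range a, f ((i:ℝ) / a) + ∑ i ∈ Finset.range b, f ((i:ℝ) / b) ≤
      ∑ i ∈ Finset.range (a + b), f ((i:ℝ) / ((a + b : ℕ) : ℝ)) := by
  rcases Nat.eq_zero_or_pos a with rfl | ha
  · simp
  rcases Nat.eq_zero_or_pos b with rfl | hb
  · simp
  have hφ : ∀ i : ℕ, ∃ k : ℕ, i * (a + b) ≤ k * a ∧ k * a < i * (a + b) + a := by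
    intro i
    refine ⟨(i * (a + b) + (a - 1)) / a, ?_, ?_⟩
    · have := Nat.lt_div_mul_add (a := i * (a + b) + (a - 1)) ha
      omega
    · have := Nat.div_mul_le_self (i * (a + b) + (a - 1)) a
      omega
  have hψ : ∀ i : ℕ, ∃ k : ℕ, i * (a + b) < k * b ∧ k * b ≤ i * (a + b) + b := by
    intro i
    refine ⟨i * (a + b) / b + 1, ?_, ?_⟩
    · have := Nat.lt_div_mul_add (a := i * (a + b)) hb
      rw [add_mul]; omega
    · have := Nat.div_mul_le_self (i * (a + b)) b
      rw [add_mul]; omega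
  choose φ hφ1 hφ2 using hφ
  choose ψ hψ1 hψ2 using hψ
  have hN : (0:ℝ) < ((a + b : ℕ) : ℝ) := by exact_mod_cast (by omega : 0 < a + b)
  have haR : (0:ℝ) < a := by exact_mod_cast ha
  have hbR : (0:ℝ) < b := by exact_mod_cast hb
  have hφN : ∀ i < a, φ i < a + b := by
    intro i hi
    have h := hφ2 i
    by_contra hc
    push Not at hc
    nlinarith [Nat.mul_le_mul_right a hc, Nat.mul_le_mul_right (a + b) (Nat.succ_le_of_lt hi)]
  have hψN : ∀ i < b, ψ i < a + b := by
    intro i hi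
    have h := hψ2 i
    by_contra hc
    push Not at hc
    nlinarith [Nat.mul_le_mul_right b hc, Nat.mul_le_mul_right (a + b) (Nat.succ_le_of_lt hi)]
  have hφi : Function.Injective φ := by
    intro i j h
    have h1 := hφ1 i
    have h2 := hφ2 i
    have h3 := hφ1 j
    have h4 := hφ2 j
    rw [h] at h1 h2
    rcases lt_trichotomy i j with hl | hl | hl
    · nlinarith [Nat.mul_le_mul_right (a + b) (Nat.succ_le_of_lt hl)]
    · exact hl
    · nlinarith [Nat.mul_le_mul_right (a + b) (Nat.succ_le_of_lt hl)]
  have hψi : Function.Injective ψ := by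
    intro i j h
    have h1 := hψ1 i
    have h2 := hψ2 i
    have h3 := hψ1 j
    have h4 := hψ2 j
    rw [h] at h1 h2
    rcases lt_trichotomy i j with hl | hl | hl
    · nlinarith [Nat.mul_le_mul_right (a + b) (Nat.succ_le_of_lt hl)]
    · exact hl
    · nlinarith [Nat.mul_le_mul_right (a + b) (Nat.succ_le_of_lt hl)]
  have hd : ∀ i j, φ i ≠ ψ j := by
    intro i j h
    have h1 := hφ1 i
    have h2 := hφ2 i
    have h3 := hψ1 j
    have h4 := hψ2 j
    rw [h] at h1 h2
    have e1 : (i + j) * (a + b) < ψ j * (a + b) := by nlinarith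
    have e2 : ψ j * (a + b) < (i + j + 1) * (a + b) := by nlinarith
    have e3 := Nat.lt_of_mul_lt_mul_right e1
    have e4 := Nat.lt_of_mul_lt_mul_right e2
    omega
  set F : ℕ → ℝ := fun k => f ((k:ℝ) / ((a + b : ℕ) : ℝ)) with hF
  have hFlt : ∀ k < a + b, (k:ℝ) / ((a + b : ℕ) : ℝ) < 1 := by
    intro k hk
    rw [div_lt_one hN]; exact_mod_cast hk
  have hA : ∑ i ∈ Finset.range a, f ((i:ℝ) / a) ≤ ∑ i ∈ Finset.range a, F (φ i) := by
    refine Finset.sum_le_sum fun i hi => ?_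
    refine hf _ _ (by positivity) ?_ (hFlt _ (hφN i (Finset.mem_range.1 hi)))
    rw [div_le_div_iff₀ haR hN]
    exact_mod_cast hφ1 i
  have hB : ∑ i ∈ Finset.range b, f ((i:ℝ) / b) ≤ ∑ i ∈ Finset.range b, F (ψ i) := by
    refine Finset.sum_le_sum fun i hi => ?_
    refine hf _ _ (by positivity) ?_ (hFlt _ (hψN i (Finset.mem_range.1 hi)))
    rw [div_le_div_iff₀ hbR hN]
    exact_mod_cast (hψ1 i).le
  refine (add_le_add hA hB).trans ?_
  rw [← Finset.sum_image (f := F) (g := φ) (hφi.injOn),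
    ← Finset.sum_image (f := F) (g := ψ) (hψi.injOn), ← Finset.sum_union]
  · refine Finset.sum_le_sum_of_subset_of_nonneg ?_ ?_
    · intro k hk
      simp only [Finset.mem_union, Finset.mem_image, Finset.mem_range] at hk ⊢
      rcases hk with ⟨i, hi, rfl⟩ | ⟨i, hi, rfl⟩
      · exact hφN i hi
      · exact hψN i hi
    · intro k hk _
      rw [← h0]
      exact hf _ _ le_rfl (by positivity) (hFlt _ (Finset.mem_range.1 hk))
  · rw [Finset.disjoint_left]
    intro k hk hk'
    simp only [Finset.mem_image] at hk hk'
    obtain ⟨i, _, rfl⟩ := hk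
    obtain ⟨j, _, h⟩ := hk'
    exact hd i j h.symm

lemma aux_f (t : ℝ) (ht0 : 0 ≤ t) (ht1 : t ≤ 1) (x y : ℝ) (hx : 0 ≤ x) (hxy : x ≤ y)
    (hy : y < 1) : -Real.log (1 - t * x) - t * x ≤ -Real.log (1 - t * y) - t * y := by
  have hu : 0 < 1 - t * y := by nlinarith
  have hv : 0 < 1 - t * x := by nlinarith
  have h := Real.log_le_sub_one_of_pos (div_pos hu hv)
  rw [Real.log_div hu.ne' hv.ne'] at h
  have h2 : (1 - t * y) / (1 - t * x) - 1 ≤ -(t * (y - x)) := by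
    rw [sub_le_iff_le_add, div_le_iff₀ hv]
    nlinarith [mul_nonneg (mul_nonneg ht0 (sub_nonneg.2 hxy)) (mul_nonneg ht0 hx)]
  linarith

lemma aux_sum (t : ℝ) (n : ℕ) (hn : 1 ≤ n) :
    ∑ i ∈ Finset.range n, (-Real.log (1 - t * ((i:ℝ) / n)) - t * ((i:ℝ) / n)) =
      -(∑ i ∈ Finset.range n, Real.log (1 - t * (i:ℝ) / n)) - t * ((n:ℝ) - 1) / 2 := by
  have hn' : (n:ℝ) ≠ 0 := by positivity
  have hg : ∀ k : ℕ, ∑ i ∈ Finset.range k, (i:ℝ) = k * (k - 1) / 2 := by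
    intro k
    induction k with
    | zero => simp
    | succ k ih => rw [Finset.sum_range_succ, ih]; push_cast; ring
  rw [Finset.sum_sub_distrib, Finset.sum_neg_distrib, ← Finset.mul_sum, ← Finset.sum_div, hg]
  simp only [mul_div_assoc]
  field_simp


/-- If `n ≥ m ≥ 1` and `n₁,…,n_m` are positive integers with `n₁ + ⋯ + n_m = n`, then for
every `t ∈ [0,1]`:
`Σ_{k=1}^m Σ_{i=0}^{n_k−1} log(1 − t·i/n_k) − Σ_{i=0}^{n−1} log(1 − t·i/n) ≥ (m−1)·t/2`. -/
theorem log_sum_inequality (n m : ℕ) (hm : 1 ≤ m) (hmn : m ≤ n)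
    (nk : Fin m → ℕ) (hpos : ∀ k, 1 ≤ nk k) (hsum : ∑ k, nk k = n)
    (t : ℝ) (ht0 : 0 ≤ t) (ht1 : t ≤ 1) :
    (∑ k, ∑ i ∈ Finset.range (nk k), Real.log (1 - t * (i : ℝ) / (nk k : ℝ))) -
        ∑ i ∈ Finset.range n, Real.log (1 - t * (i : ℝ) / (n : ℝ)) ≥
      ((m : ℝ) - 1) * t / 2 := by
  set f : ℝ → ℝ := fun x => -Real.log (1 - t * x) - t * x with hf
  have key : ∀ s : Finset (Fin m), ∑ k ∈ s, ∑ i ∈ Finset.range (nk k), f ((i:ℝ) / (nk k : ℝ)) ≤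
      ∑ i ∈ Finset.range (∑ k ∈ s, nk k), f ((i:ℝ) / ((∑ k ∈ s, nk k : ℕ) : ℝ)) := by
    intro s
    induction s using Finset.induction_on with
    | empty => simp
    | insert a s ha ih =>
      rw [Finset.sum_insert ha, Finset.sum_insert ha]
      refine le_trans ?_ (aux_mono f (fun x y => aux_f t ht0 ht1 x y) (by simp [hf]) _ _)
      linarith
  have h := key Finset.univ
  rw [hsum] at h
  simp only [hf] at h
  rw [aux_sum t n (hm.trans hmn), Finset.sum_congr rfl (fun k _ => aux_sum t (nk k) (hpos k)),
    Finset.sum_sub_distrib, Finset.sum_neg_distrib, ← Finset.sum_div, ← Finset.mul_sum,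
    Finset.sum_sub_distrib] at h
  have hs : ∑ k, (nk k : ℝ) = n := by exact_mod_cast hsum
  rw [hs] at h
  simp only [Finset.sum_const, Finset.card_univ, Fintype.card_fin, nsmul_eq_mul, mul_one] at h
  linarith
end
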